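/- Let d ≥ 2 and let J ⊆ S be a homogeneous ideal that is generated by its degree-d component J_d and satisfies dim_k S/J < ∞ (i.e., J has codimension n). Then either J is a balanced complete intersection ideal of type (d)^n, i.e., J is generated by a regular sequence of n homogeneous forms of degree d, or every homogeneous form of degree n(d−1) lies in J, i.e., S_{n(d−1)} ⊆ J (equivalently, (S/J)_{n(d−1)} = 0). -/

import Mathlib

open MvPolynomial

section GradedIdeals

variable {k σ : Type*} [Field k]

attribute [local instance] MvPolynomial.gradedAlgebra

theorem homogeneousComponent_add_mul {a : MvPolynomial σ k} {e : ℕ} (ha : a.IsHomogeneous e)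
    (p : MvPolynomial σ k) (j : ℕ) :
    homogeneousComponent (e + j) (a * p) = a * homogeneousComponent j p := by
  simp only [← decomposition.decompose'_apply]
  exact DirectSum.coe_decompose_mul_add_of_left_mem (homogeneousSubmodule σ k) (b := p) (j := j) ha

theorem homogeneousComponent_mul_of_lt {a : MvPolynomial σ k} {e : ℕ} (ha : a.IsHomogeneous e)
    (p : MvPolynomial σ k) {j : ℕ} (hj : j < e) :
    homogeneousComponent j (a * p) = 0 := by
  rw [← decomposition.decompose'_apply]
  exact DirectSum.coe_decompose_mul_of_left_mem_of_not_le (homogeneousSubmodule σ k) (b := p) ha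
    (not_le.2 hj)

theorem homogeneousComponent_mem_span {s : Set (MvPolynomial σ k)}
    (hs : ∀ x ∈ s, ∃ e, x.IsHomogeneous e) {p : MvPolynomial σ k} (hp : p ∈ Ideal.span s)
    (j : ℕ) : homogeneousComponent j p ∈ Ideal.span s :=
  homogeneousComponent_mem_of_mem
    (Ideal.homogeneous_span (homogeneousSubmodule σ k) s fun x hx => hs x hx) hp j

end GradedIdeals

section NonZeroDivisors

theorem Ideal.mem_sup_span_singleton_iff {R : Type*} [CommRing R] {I : Ideal R} {a u : R} :
    u ∈ I ⊔ Ideal.span {a} ↔ ∃ t, u - a * t ∈ I := by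
  constructor
  · intro h
    obtain ⟨p, hp, q, hq, rfl⟩ := Submodule.mem_sup.1 h
    obtain ⟨t, rfl⟩ := Ideal.mem_span_singleton'.1 hq
    exact ⟨t, by simpa [mul_comm] using hp⟩
  · rintro ⟨t, ht⟩
    exact Submodule.mem_sup.2
      ⟨_, ht, _, Ideal.mem_span_singleton.2 (dvd_mul_right a t), by ring⟩

/-- `a` is a nonzerodivisor modulo the ideal `I`. -/
def NonZeroDivisorMod {R : Type*} [CommRing R] (I : Ideal R) (a : R) : Prop :=
  ∀ u, a * u ∈ I → u ∈ I

/-- `L` is a weakly regular sequence on `R ⧸ I`. -/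
def RegularMod {R : Type*} [CommRing R] : Ideal R → List R → Prop
  | _, [] => True
  | I, a :: L => NonZeroDivisorMod I a ∧ RegularMod (I ⊔ Ideal.span {a}) L

theorem regularMod_append {R : Type*} [CommRing R] (I : Ideal R) (L M : List R) :
    RegularMod I (L ++ M) ↔ RegularMod I L ∧ RegularMod (I ⊔ Ideal.ofList L) M := by
  induction L generalizing I with
  | nil => simp [RegularMod]
  | cons a L ih => simp [RegularMod, ih, and_assoc, sup_assoc]

theorem RegularMod.nonZeroDivisorMod_getElem {R : Type*} [CommRing R] {I : Ideal R} {L : List R}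
    (h : RegularMod I L) (i : ℕ) (hi : i < L.length) :
    NonZeroDivisorMod (I ⊔ Ideal.ofList (L.take i)) L[i] := by
  induction L generalizing I i with
  | nil => simp at hi
  | cons a L ih =>
    cases i with
    | zero => simpa using h.1
    | succ i => simpa [sup_assoc] using ih h.2 i (by simpa using hi)

theorem RegularMod.isWeaklyRegular {R : Type*} [CommRing R] {L : List R}
    (h : RegularMod (⊥ : Ideal R) L) : RingTheory.Sequence.IsWeaklyRegular R L := by
  refine ⟨fun i hi => ?_⟩
  rw [isSMulRegular_quotient_iff_mem_of_smul_mem]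
  simpa [NonZeroDivisorMod] using h.nonZeroDivisorMod_getElem i hi

end NonZeroDivisors

section Permutation

variable {k σ : Type*} [Field k]

theorem NonZeroDivisorMod.swap {I : Ideal (MvPolynomial σ k)}
    (hI : ∀ p ∈ I, ∀ j, homogeneousComponent j p ∈ I) {a b : MvPolynomial σ k} {e : ℕ}
    (he : 0 < e) (ha : a.IsHomogeneous e) (hna : NonZeroDivisorMod I a)
    (hnb : NonZeroDivisorMod (I ⊔ Ideal.span {a}) b) :
    NonZeroDivisorMod I b ∧ NonZeroDivisorMod (I ⊔ Ideal.span {b}) a := by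
  constructor
  · have key : ∀ N u, b * u ∈ I → ∃ t, u - a ^ N * t ∈ I := by
      intro N
      induction N with
      | zero => exact fun u _ => ⟨u, by simp⟩
      | succ N ih =>
        intro u hu
        obtain ⟨t, ht⟩ := Ideal.mem_sup_span_singleton_iff.1
          (hnb u (Ideal.mem_sup_left hu))
        have h1 : b * t ∈ I := hna _ <| by
          have := I.sub_mem hu (I.mul_mem_left b ht)
          convert this using 1; ring
        obtain ⟨v, hv⟩ := ih t h1
        refine ⟨v, ?_⟩
        have := I.add_mem ht (I.mul_mem_left a hv)
        convert this using 1; ring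
    intro u hu
    rw [← sum_homogeneousComponent u]
    refine Ideal.sum_mem _ fun j _ => ?_
    obtain ⟨t, ht⟩ := key (j + 1) u hu
    have := hI _ ht j
    rwa [map_sub, homogeneousComponent_mul_of_lt (ha.pow (j + 1)) t, sub_zero] at this
    nlinarith
  · intro u hu
    obtain ⟨v, hv⟩ := Ideal.mem_sup_span_singleton_iff.1 hu
    obtain ⟨t, ht⟩ := Ideal.mem_sup_span_singleton_iff.1 <| hnb v <|
      Ideal.mem_sup_span_singleton_iff.2 ⟨u, by simpa using I.neg_mem hv⟩
    refine Ideal.mem_sup_span_singleton_iff.2 ⟨t, hna _ ?_⟩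
    have := I.add_mem hv (I.mul_mem_left b ht)
    convert this using 1; ring

theorem homogeneousComponent_mem_sup_span {I : Ideal (MvPolynomial σ k)}
    (hI : ∀ p ∈ I, ∀ j, homogeneousComponent j p ∈ I) {a : MvPolynomial σ k} {e : ℕ}
    (ha : a.IsHomogeneous e) :
    ∀ p ∈ I ⊔ Ideal.span {a}, ∀ j, homogeneousComponent j p ∈ I ⊔ Ideal.span {a} := by
  intro p hp j
  obtain ⟨q, hq, r, hr, rfl⟩ := Submodule.mem_sup.1 hp
  rw [map_add]
  refine add_mem (Ideal.mem_sup_left (hI q hq j)) (Ideal.mem_sup_right ?_)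
  exact homogeneousComponent_mem_span (by rintro x rfl; exact ⟨e, ha⟩) hr j

theorem RegularMod.perm {L M : List (MvPolynomial σ k)} (h : L.Perm M)
    (hL : ∀ a ∈ L, ∃ e, 0 < e ∧ a.IsHomogeneous e) {I : Ideal (MvPolynomial σ k)}
    (hI : ∀ p ∈ I, ∀ j, homogeneousComponent j p ∈ I) (hr : RegularMod I L) :
    RegularMod I M := by
  induction h generalizing I with
  | nil => trivial
  | cons a _ ih =>
    obtain ⟨e, -, ha⟩ := hL a (by simp)
    exact ⟨hr.1, ih (fun b hb => hL b (by simp [hb])) (homogeneousComponent_mem_sup_span hI ha)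
      hr.2⟩
  | swap a b L =>
    obtain ⟨e, he, hb⟩ := hL b (by simp)
    obtain ⟨h1, h2, h3⟩ := hr
    obtain ⟨h4, h5⟩ := NonZeroDivisorMod.swap hI he hb h1 h2
    refine ⟨h4, h5, ?_⟩
    rwa [sup_right_comm]
  | trans h₁ _ ih₁ ih₂ =>
    exact ih₂ (fun a ha => hL a (h₁.mem_iff.2 ha)) hI (ih₁ hL hI hr)

theorem Ideal.ofList_perm {R : Type*} [CommRing R] {L M : List R} (h : L.Perm M) :
    Ideal.ofList L = Ideal.ofList M := by
  simp only [Ideal.ofList, h.mem_iff]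

theorem homogeneousComponent_mem_ofList {L : List (MvPolynomial σ k)}
    (hL : ∀ a ∈ L, ∃ e, a.IsHomogeneous e) :
    ∀ p ∈ Ideal.ofList L, ∀ j, homogeneousComponent j p ∈ Ideal.ofList L :=
  fun _ hp j => homogeneousComponent_mem_span hL hp j

end Permutation

section Variables

variable {k σ : Type*} [Field k]

theorem nonZeroDivisorMod_X {s : Set σ} {i : σ} (hi : i ∉ s) :
    NonZeroDivisorMod (Ideal.span ((X : σ → MvPolynomial σ k) '' s)) (X i) := by
  classical
  intro u hu
  rw [mem_ideal_span_X_image] at hu ⊢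
  intro m hm
  obtain ⟨j, hj, hmj⟩ := hu (m + Finsupp.single i 1) (by
    rw [mem_support_iff, mul_comm, coeff_mul_X]; exact mem_support_iff.1 hm)
  refine ⟨j, hj, ?_⟩
  have : i ≠ j := fun h => hi (h ▸ hj)
  simpa [Finsupp.single_apply, this] using hmj

theorem regularMod_map_X (l : List σ) (hl : l.Nodup) (s : Set σ) (hs : ∀ i ∈ l, i ∉ s) :
    RegularMod (Ideal.span ((X : σ → MvPolynomial σ k) '' s)) (l.map X) := by
  induction l generalizing s with
  | nil => trivial
  | cons i l ih =>
    refine ⟨nonZeroDivisorMod_X (hs i (by simp)), ?_⟩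
    rw [← Ideal.span_union, Set.union_singleton, ← Set.image_insert_eq]
    rw [List.nodup_cons] at hl
    refine ih hl.2 _ fun j hj => ?_
    rintro (rfl | h)
    · exact hl.1 hj
    · exact hs j (by simp [hj]) h

theorem MvPolynomial.IsHomogeneous.mem_span_range_X {p : MvPolynomial σ k} {e : ℕ}
    (hp : p.IsHomogeneous e) (he : 0 < e) :
    p ∈ Ideal.span (Set.range (X : σ → MvPolynomial σ k)) := by
  rw [← Set.image_univ, mem_ideal_span_X_image]
  intro m hm
  by_contra! h
  have : m = 0 := by ext i; simpa using h i
  have h2 := hp.degree_eq_sum_deg_support hm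
  simp [this] at h2
  omega

theorem mul_mem_of_forall_X_mul_mem {K : Ideal (MvPolynomial σ k)} {u r : MvPolynomial σ k}
    (hu : ∀ i, X i * u ∈ K) {e : ℕ} (hr : r.IsHomogeneous e) (he : 0 < e) : r * u ∈ K := by
  refine Submodule.span_induction (p := fun r _ => r * u ∈ K) ?_ (by simp) ?_ ?_
    (hr.mem_span_range_X he)
  · rintro _ ⟨i, rfl⟩; exact hu i
  · intro x y _ _ hx hy; rw [add_mul]; exact K.add_mem hx hy
  · intro c x _ hx; rw [smul_eq_mul, mul_assoc]; exact K.mul_mem_left c hx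

end Variables

section Socle

variable {k σ : Type*} [Field k]

/-- The socle of `k[σ] ⧸ I` is one-dimensional, spanned by the class of a form of degree `D`. -/
def HasSimpleSocle (I : Ideal (MvPolynomial σ k)) (D : ℕ) : Prop :=
  ∃ w : MvPolynomial σ k, w.IsHomogeneous D ∧ w ∉ I ∧ (∀ i, X i * w ∈ I) ∧
    ∀ u, (∀ i, X i * u ∈ I) → ∃ c : k, u - C c * w ∈ I

/-- `I` contains all forms of sufficiently high degree. -/
def ContainsHighDegree (I : Ideal (MvPolynomial σ k)) : Prop :=
  ∃ N, ∀ j, N ≤ j → ∀ p : MvPolynomial σ k, p.IsHomogeneous j → p ∈ I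

theorem HasSimpleSocle.exchange {I : Ideal (MvPolynomial σ k)}
    (hI : ∀ p ∈ I, ∀ j, homogeneousComponent j p ∈ I) {a b : MvPolynomial σ k} {e f D D' : ℕ}
    (he : 0 < e) (hf : 0 < f) (ha : a.IsHomogeneous e) (hb : b.IsHomogeneous f)
    (hna : NonZeroDivisorMod I a) (hnb : NonZeroDivisorMod I b) (hD : e + D' = f + D)
    (h : HasSimpleSocle (I ⊔ Ideal.span {a}) D) : HasSimpleSocle (I ⊔ Ideal.span {b}) D' := by
  obtain ⟨w, hw, hwI, hXw, hsoc⟩ := h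
  simp only [Ideal.mem_sup_span_singleton_iff] at hwI hXw hsoc
  have hbw : b * w ∈ I ⊔ Ideal.span {a} :=
    mul_mem_of_forall_X_mul_mem (fun i => Ideal.mem_sup_span_singleton_iff.2 (hXw i)) hb hf
  obtain ⟨v', hv'⟩ := Ideal.mem_sup_span_singleton_iff.1 hbw
  obtain ⟨v, hv, hvI⟩ : ∃ v : MvPolynomial σ k, v.IsHomogeneous D' ∧ b * w - a * v ∈ I := by
    refine ⟨homogeneousComponent D' v', homogeneousComponent_isHomogeneous _ _, ?_⟩
    have := hI _ hv' (e + D')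
    rwa [map_sub, homogeneousComponent_add_mul ha, hD,
      homogeneousComponent_eq_self (hb.mul hw)] at this
  refine ⟨v, hv, ?_, ?_, ?_⟩
  · rw [Ideal.mem_sup_span_singleton_iff]
    rintro ⟨s, hs⟩
    refine hwI ⟨s, hnb _ ?_⟩
    have := I.add_mem hvI (I.mul_mem_left a hs)
    convert this using 1; ring
  · intro i
    obtain ⟨t, ht⟩ := hXw i
    refine Ideal.mem_sup_span_singleton_iff.2 ⟨t, hna _ ?_⟩
    have := I.sub_mem (I.mul_mem_left b ht) (I.mul_mem_left (X i) hvI)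
    convert this using 1; ring
  · intro u hu
    obtain ⟨s, hs⟩ := Ideal.mem_sup_span_singleton_iff.1 (mul_mem_of_forall_X_mul_mem hu ha he)
    obtain ⟨c, t, hct⟩ := hsoc s fun i => by
      obtain ⟨t, ht⟩ := Ideal.mem_sup_span_singleton_iff.1 (hu i)
      refine ⟨t, hnb _ ?_⟩
      have := I.sub_mem (I.mul_mem_left a ht) (I.mul_mem_left (X i) hs)
      convert this using 1; ring
    refine ⟨c, Ideal.mem_sup_span_singleton_iff.2 ⟨t, hna _ ?_⟩⟩
    have := I.add_mem (I.add_mem hs (I.mul_mem_left b hct)) (I.mul_mem_left (C c) hvI)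
    convert this using 1; ring

theorem exists_sub_pow_mul_mem {I : Ideal (MvPolynomial σ k)}
    (hI : ∀ p ∈ I, ∀ j, homogeneousComponent j p ∈ I) {a : MvPolynomial σ k}
    (ha : a.IsHomogeneous 1) {N : ℕ}
    (hN : ∀ j, N ≤ j → ∀ p : MvPolynomial σ k, p.IsHomogeneous j → p ∈ I ⊔ Ideal.span {a})
    {j : ℕ} (hj : N ≤ j) (f : ℕ) (p : MvPolynomial σ k) (hp : p.IsHomogeneous (j + f)) :
    ∃ q : MvPolynomial σ k, q.IsHomogeneous j ∧ p - a ^ f * q ∈ I := by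
  induction f generalizing p with
  | zero => exact ⟨p, hp, by simp⟩
  | succ f ih =>
    obtain ⟨t, ht⟩ := Ideal.mem_sup_span_singleton_iff.1 (hN _ (by omega) p hp)
    have h1 := hI _ ht (1 + (j + f))
    rw [map_sub, homogeneousComponent_add_mul ha,
      homogeneousComponent_eq_self (by convert hp using 1; ring)] at h1
    obtain ⟨q, hq, hqI⟩ := ih _ (homogeneousComponent_isHomogeneous (j + f) t)
    refine ⟨q, hq, ?_⟩
    have := I.add_mem h1 (I.mul_mem_left a hqI)
    convert this using 1; ring

theorem ContainsHighDegree.exchange [Finite σ] {I : Ideal (MvPolynomial σ k)}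
    (hI : ∀ p ∈ I, ∀ j, homogeneousComponent j p ∈ I) {a b : MvPolynomial σ k} {f : ℕ}
    (ha : a.IsHomogeneous 1) (hb : b.IsHomogeneous f) (hnb : NonZeroDivisorMod I b)
    (h : ContainsHighDegree (I ⊔ Ideal.span {a})) :
    ContainsHighDegree (I ⊔ Ideal.span {b}) := by
  obtain ⟨N, hN⟩ := h
  refine ⟨N + f, fun j' hj' p hp => ?_⟩
  obtain ⟨j, rfl⟩ : ∃ j, j' = j + f := ⟨j' - f, by omega⟩
  have hj : N ≤ j := by omega
  let π : MvPolynomial σ k →ₗ[k] MvPolynomial σ k ⧸ I := (Ideal.Quotient.mkₐ k I).toLinearMap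
  let V : ℕ → Submodule k (MvPolynomial σ k ⧸ I) := fun j => (homogeneousSubmodule σ k j).map π
  have hV : ∀ j, FiniteDimensional k (V j) := fun j =>
    Module.Finite.iff_fg.2 ((homogeneousSubmodule_fg (σ := σ) (R := k) j).map π)
  let A := LinearMap.mulLeft k (π (a ^ f))
  let B := LinearMap.mulLeft k (π b)
  have hπ : ∀ x y, π (x * y) = π x * π y := fun x y => map_mul (Ideal.Quotient.mkₐ k I) x y
  have hA : V (j + f) ≤ (V j).map A := by
    rintro _ ⟨p, hp, rfl⟩
    obtain ⟨q, hq, hqI⟩ := exists_sub_pow_mul_mem hI ha hN hj f p hp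
    refine ⟨π q, ⟨q, hq, rfl⟩, ?_⟩
    change π (a ^ f) * π q = π p
    rw [← hπ]
    exact (Ideal.Quotient.eq.2 hqI).symm
  have hB : (V j).map B ≤ V (j + f) := by
    rintro _ ⟨_, ⟨q, hq, rfl⟩, rfl⟩
    exact ⟨b * q, by rw [add_comm]; exact hb.mul hq, hπ b q⟩
  have hBinj : Function.Injective B := by
    rw [injective_iff_map_eq_zero]
    intro x hx
    obtain ⟨x, rfl⟩ := Ideal.Quotient.mk_surjective x
    refine Ideal.Quotient.eq_zero_iff_mem.2 (hnb _ (Ideal.Quotient.eq_zero_iff_mem.1 ?_))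
    rw [map_mul]
    exact hx
  have hfin : Module.finrank k (V (j + f)) ≤ Module.finrank k ((V j).map B) := by
    rw [← (Submodule.equivMapOfInjective B hBinj (V j)).finrank_eq]
    exact (Submodule.finrank_mono hA).trans (Submodule.finrank_map_le A (V j))
  have heq := Submodule.eq_of_le_of_finrank_le hB hfin
  have hpV : π p ∈ (V j).map B := heq ▸ ⟨p, hp, rfl⟩
  obtain ⟨_, ⟨q, -, rfl⟩, hq⟩ := hpV
  refine Ideal.mem_sup_span_singleton_iff.2 ⟨q, Ideal.Quotient.eq.1 ?_⟩
  rw [map_mul]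
  exact hq.symm

theorem exists_form_mul_mem_socle {K : Ideal (MvPolynomial σ k)} (hK : ContainsHighDegree K)
    {f : MvPolynomial σ k} (hf : f ∉ K) :
    ∃ (t : ℕ) (m : MvPolynomial σ k), m.IsHomogeneous t ∧ m * f ∉ K ∧
      ∀ i, X i * (m * f) ∈ K := by
  by_contra! h
  have key : ∀ t, ∃ m : MvPolynomial σ k, m.IsHomogeneous t ∧ m * f ∉ K := by
    intro t
    induction t with
    | zero => exact ⟨1, isHomogeneous_one σ k, by simpa⟩
    | succ t ih =>
      obtain ⟨m, hm, hmf⟩ := ih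
      obtain ⟨i, hi⟩ := h t m hm hmf
      exact ⟨X i * m, by rw [add_comm]; exact (isHomogeneous_X k i).mul hm, by rwa [mul_assoc]⟩
  obtain ⟨N, hN⟩ := hK
  obtain ⟨m, hm, hmf⟩ := key N
  exact hmf (K.mul_mem_right f (hN N le_rfl m hm))

/-- An ideal strictly containing an ideal `K` with simple socle contains all forms in the
socle degree. -/
theorem HasSimpleSocle.mem_of_not_le {K J : Ideal (MvPolynomial σ k)} {D : ℕ}
    (hK : ∀ p ∈ K, ∀ j, homogeneousComponent j p ∈ K) (hs : HasSimpleSocle K D)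
    (hh : ContainsHighDegree K) (hKJ : K ≤ J) (hJK : ¬ J ≤ K) {p : MvPolynomial σ k}
    (hp : p.IsHomogeneous D) : p ∈ J := by
  obtain ⟨w, hw, -, -, hsoc⟩ := hs
  obtain ⟨f, hfJ, hfK⟩ := SetLike.not_le_iff_exists.1 hJK
  have hwJ : w ∈ J := by
    obtain ⟨t, m, -, hmf, hX⟩ := exists_form_mul_mem_socle hh hfK
    obtain ⟨c, hc⟩ := hsoc _ hX
    have hc0 : c ≠ 0 := by rintro rfl; simp at hc; exact hmf hc
    have h1 : C c * w ∈ J := by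
      simpa using J.sub_mem (J.mul_mem_left m hfJ) (hKJ hc)
    have h2 := J.mul_mem_left (C c⁻¹) h1
    rwa [← mul_assoc, ← C_mul, inv_mul_cancel₀ hc0, C_1, one_mul] at h2
  by_cases hpK : p ∈ K
  · exact hKJ hpK
  obtain ⟨t, m, hm, hmp, hX⟩ := exists_form_mul_mem_socle hh hpK
  obtain ⟨c, hc⟩ := hsoc _ hX
  rcases Nat.eq_zero_or_pos t with rfl | ht
  · have hXp : ∀ i, X i * p ∈ K := by
      intro i
      obtain ⟨c', rfl⟩ : ∃ c', m = C c' := ⟨_, totalDegree_eq_zero_iff_eq_C.1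
        ((totalDegree_zero_iff_isHomogeneous σ).2 hm)⟩
      have hc0 : c' ≠ 0 := by rintro rfl; simp at hmp
      have h2 := K.mul_mem_left (C c'⁻¹) (hX i)
      rwa [show C c'⁻¹ * (X i * (C c' * p)) = (C c'⁻¹ * C c') * (X i * p) by ring,
        ← C_mul, inv_mul_cancel₀ hc0, C_1, one_mul] at h2
    obtain ⟨c, hc⟩ := hsoc _ hXp
    simpa using J.add_mem (hKJ hc) (J.mul_mem_left (C c) hwJ)
  · have h1 := hK _ hc (t + D)
    rw [map_sub, homogeneousComponent_eq_self (hm.mul hp), homogeneousComponent_C_mul,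
      homogeneousComponent_of_mem hw, if_neg (by omega), mul_zero, sub_zero] at h1
    exact absurd h1 hmp

end Socle

section Selection

theorem exists_X_pow_mem {k σ : Type*} [Field k] {J : Ideal (MvPolynomial σ k)}
    (hJ : ∀ p ∈ J, ∀ j, homogeneousComponent j p ∈ J)
    (hfin : Module.Finite k (MvPolynomial σ k ⧸ J)) (i : σ) :
    ∃ N, (X i : MvPolynomial σ k) ^ N ∈ J := by
  obtain ⟨f, hf, hf0⟩ := Algebra.IsIntegral.isIntegral (R := k) (Ideal.Quotient.mk J (X i))
  have h1 : Polynomial.aeval (X i : MvPolynomial σ k) f ∈ J := by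
    rw [← Ideal.Quotient.eq_zero_iff_mem]
    change Ideal.Quotient.mkₐ k J _ = 0
    rw [← Polynomial.aeval_algHom_apply]
    exact hf0
  refine ⟨f.natDegree, ?_⟩
  have h2 := hJ _ h1 f.natDegree
  rw [Polynomial.aeval_eq_sum_range, map_sum, Finset.sum_eq_single f.natDegree] at h2
  · simpa [hf.coeff_natDegree, homogeneousComponent_eq_self (isHomogeneous_X_pow i _)] using h2
  · intro j _ hj
    rw [map_smul, homogeneousComponent_of_mem (isHomogeneous_X_pow i j), if_neg hj.symm, smul_zero]
  · simp

/-- An ideal generated in degree `d` and containing powers of the variables contains a form of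
degree `d` that is a nonzerodivisor modulo `I`, as soon as some variable is one. -/
theorem exists_homogeneous_nonZeroDivisorMod {k σ : Type*} [Field k] [Infinite k] [Finite σ]
    {I J : Ideal (MvPolynomial σ k)} {d : ℕ}
    (hgen : J = Ideal.span {p | p ∈ J ∧ p.IsHomogeneous d}) {i : σ}
    (hpow : ∃ N, (X i : MvPolynomial σ k) ^ N ∈ J) (hi : NonZeroDivisorMod I (X i)) :
    ∃ g ∈ J, g.IsHomogeneous d ∧ NonZeroDivisorMod I g := by
  by_contra! hcon
  let W : Submodule k (MvPolynomial σ k) := J.restrictScalars k ⊓ homogeneousSubmodule σ k d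
  have hreg : ∀ g : MvPolynomial σ k, IsSMulRegular (MvPolynomial σ k ⧸ I) g ↔
      NonZeroDivisorMod I g := fun g => isSMulRegular_quotient_iff_mem_of_smul_mem I g
  have hass := biUnion_associatedPrimes_eq_compl_regular (MvPolynomial σ k) (MvPolynomial σ k ⧸ I)
  have hfinite := associatedPrimes.finite (MvPolynomial σ k) (MvPolynomial σ k ⧸ I)
  have := hfinite.to_subtype
  obtain ⟨P, hP⟩ := Subspace.exists_eq_top_of_iUnion_eq_univ (k := k) (E := W)
    (p := fun P : associatedPrimes (MvPolynomial σ k) (MvPolynomial σ k ⧸ I) =>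
      (P.1.restrictScalars k).comap W.subtype) (by
    rw [Set.eq_univ_iff_forall]
    rintro ⟨g, hgJ, hg⟩
    have : g ∈ {r | IsSMulRegular (MvPolynomial σ k ⧸ I) r}ᶜ := fun h =>
      hcon g hgJ hg ((hreg g).1 h)
    rw [← hass] at this
    simp only [Set.mem_iUnion] at this ⊢
    obtain ⟨P, hP, hgP⟩ := this
    exact ⟨⟨P, hP⟩, hgP⟩)
  have hJP : J ≤ P.1 := by
    rw [hgen, Ideal.span_le]
    rintro g ⟨hgJ, hg⟩
    have : (⟨g, hgJ, hg⟩ : W) ∈ (P.1.restrictScalars k).comap W.subtype := by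
      rw [hP]; trivial
    exact this
  obtain ⟨N, hN⟩ := hpow
  have hXP : X i ∈ P.1 := P.2.isPrime.mem_of_pow_mem N (hJP hN)
  have : (X i : MvPolynomial σ k) ∈ {r | IsSMulRegular (MvPolynomial σ k ⧸ I) r}ᶜ := by
    rw [← hass]
    exact Set.mem_biUnion P.2 hXP
  exact this ((hreg _).2 hi)

theorem exists_regular_sequence_of_variables {k σ : Type*} [Field k] [Infinite k] [Finite σ]
    {J : Ideal (MvPolynomial σ k)} {d : ℕ} (hd : 0 < d)
    (hgen : J = Ideal.span {p | p ∈ J ∧ p.IsHomogeneous d})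
    (hpow : ∀ i, ∃ N, (X i : MvPolynomial σ k) ^ N ∈ J) (l : List σ)
    (G : List (MvPolynomial σ k)) (D : ℕ) (hG : ∀ g ∈ G, g ∈ J ∧ g.IsHomogeneous d)
    (hreg : RegularMod ⊥ (l.map X ++ G)) (hsoc : HasSimpleSocle (Ideal.ofList (l.map X ++ G)) D)
    (hhigh : ContainsHighDegree (Ideal.ofList (l.map X ++ G))) :
    ∃ G' : List (MvPolynomial σ k), G'.length = l.length + G.length ∧
      (∀ g ∈ G', g ∈ J ∧ g.IsHomogeneous d) ∧ RegularMod ⊥ G' ∧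
      HasSimpleSocle (Ideal.ofList G') (D + l.length * (d - 1)) ∧
      ContainsHighDegree (Ideal.ofList G') := by
  induction l generalizing G D with
  | nil => exact ⟨G, by simp, hG, by simpa using hreg, by simpa using hsoc, by simpa using hhigh⟩
  | cons i l ih =>
    have hbot : ∀ p ∈ (⊥ : Ideal (MvPolynomial σ k)), ∀ j,
        homogeneousComponent j p ∈ (⊥ : Ideal (MvPolynomial σ k)) := by
      intro p hp j
      rw [Ideal.mem_bot] at hp
      simp [hp]
    have hhom : ∀ a ∈ l.map X ++ G, ∃ e, 0 < e ∧ a.IsHomogeneous e := by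
      intro a ha
      rcases List.mem_append.1 ha with h | h
      · obtain ⟨j, -, rfl⟩ := List.mem_map.1 h
        exact ⟨1, one_pos, isHomogeneous_X k j⟩
      · exact ⟨d, hd, (hG a h).2⟩
    have hI := homogeneousComponent_mem_ofList fun a ha => (hhom a ha).imp fun _ h => h.2
    have hlast : ∀ a : MvPolynomial σ k,
        Ideal.ofList (l.map X ++ G) ⊔ Ideal.span {a} = Ideal.ofList (a :: (l.map X ++ G)) := by
      intro a
      rw [Ideal.ofList_cons, sup_comm]
    have hXi : NonZeroDivisorMod (Ideal.ofList (l.map X ++ G)) (X i) := by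
      have h1 : RegularMod ⊥ ((l.map X ++ G) ++ [X i]) := by
        refine RegularMod.perm (List.perm_append_singleton _ _).symm ?_ hbot hreg
        intro a ha
        rcases List.mem_cons.1 ha with rfl | h
        · exact ⟨1, one_pos, isHomogeneous_X k i⟩
        · exact hhom a h
      simpa using ((regularMod_append _ _ _).1 h1).2.1
    obtain ⟨g, hgJ, hg, hgI⟩ := exists_homogeneous_nonZeroDivisorMod hgen (hpow i) hXi
    have hperm : (g :: (l.map X ++ G)).Perm (l.map X ++ g :: G) := List.perm_middle.symm
    have hregg : RegularMod ⊥ (l.map X ++ g :: G) := by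
      have h1 : RegularMod ⊥ ((l.map X ++ G) ++ [g]) := by
        rw [regularMod_append]
        exact ⟨((regularMod_append _ _ _).1 (RegularMod.perm
          (List.perm_append_singleton _ _).symm (by
            intro a ha
            rcases List.mem_cons.1 ha with rfl | h
            · exact ⟨1, one_pos, isHomogeneous_X k i⟩
            · exact hhom a h) hbot hreg)).1, by simpa using hgI, trivial⟩
      refine RegularMod.perm ((List.perm_append_singleton _ _).trans hperm) ?_ hbot h1
      intro a ha
      rcases List.mem_append.1 ha with h | h
      · exact hhom a h
      · rw [List.mem_singleton.1 h]; exact ⟨d, hd, hg⟩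
    have hsocg : HasSimpleSocle (Ideal.ofList (l.map X ++ g :: G)) (D + (d - 1)) := by
      rw [← Ideal.ofList_perm hperm, ← hlast]
      refine HasSimpleSocle.exchange hI one_pos hd (isHomogeneous_X k i) hg hXi hgI
        (D := D) (by omega) ?_
      rw [hlast]; exact hsoc
    have hhighg : ContainsHighDegree (Ideal.ofList (l.map X ++ g :: G)) := by
      rw [← Ideal.ofList_perm hperm, ← hlast]
      refine ContainsHighDegree.exchange hI (isHomogeneous_X k i) hg hgI ?_
      rw [hlast]; exact hhigh
    obtain ⟨G', h1, h2, h3, h4, h5⟩ := ih (g :: G) (D + (d - 1))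
      (by
        intro a ha
        rcases List.mem_cons.1 ha with rfl | h
        · exact ⟨hgJ, hg⟩
        · exact hG a h) hregg hsocg hhighg
    refine ⟨G', by simp [h1]; omega, h2, h3, ?_, h5⟩
    convert h4 using 1
    simp [add_mul]; omega

theorem hasSimpleSocle_span_range_X {k σ : Type*} [Field k] :
    HasSimpleSocle (Ideal.span (Set.range (X : σ → MvPolynomial σ k))) 0 := by
  refine ⟨1, isHomogeneous_one σ k, ?_, fun i => ?_, fun u _ => ⟨coeff 0 u, ?_⟩⟩
  · rw [← Set.image_univ, mem_ideal_span_X_image]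
    intro h
    obtain ⟨i, -, hi⟩ := h 0 (by simp)
    simp at hi
  · simpa using Ideal.subset_span (Set.mem_range_self i)
  · classical
    rw [← Set.image_univ, mem_ideal_span_X_image]
    intro m hm
    by_contra! h
    have : m = 0 := by ext i; simpa using h i
    simp [this] at hm

end Selection

/-- Lemma 2.8: if `J` is a homogeneous ideal generated by its degree-`d` component with
`dim_k S/J < ∞`, then either `J` is a balanced complete intersection of type `(d)^n`, or
`(S/J)_{n(d-1)} = 0`, i.e. every form of degree `n(d-1)` lies in `J`. -/
theorem stmt14 {k : Type*} [Field k] [CharZero k] {n d : ℕ} (hd : 2 ≤ d)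
    (J : Ideal (MvPolynomial (Fin n) k))
    (hgen : J = Ideal.span {p | p ∈ J ∧ p.IsHomogeneous d})
    (hfin : Module.Finite k (MvPolynomial (Fin n) k ⧸ J)) :
    (∃ g : Fin n → MvPolynomial (Fin n) k, (∀ i, (g i).IsHomogeneous d) ∧
      RingTheory.Sequence.IsRegular (MvPolynomial (Fin n) k) (List.ofFn g) ∧
      J = Ideal.span (Set.range g)) ∨
    (∀ p : MvPolynomial (Fin n) k, p.IsHomogeneous (n * (d - 1)) → p ∈ J) := by
  have hJ : ∀ p ∈ J, ∀ j, homogeneousComponent j p ∈ J := by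
    intro p hp j
    rw [hgen] at hp ⊢
    exact homogeneousComponent_mem_span (fun x hx => ⟨d, hx.2⟩) hp j
  have hvars : Ideal.ofList ((List.finRange n).map X ++ []) =
      Ideal.span (Set.range (X : Fin n → MvPolynomial (Fin n) k)) := by
    simp [Ideal.ofList, Set.range]
  obtain ⟨G, hlen, hG, hreg, hsoc, hhigh⟩ := exists_regular_sequence_of_variables
    (by omega) hgen (exists_X_pow_mem hJ hfin) (List.finRange n) [] 0 (by simp)
    (by simpa using regularMod_map_X (k := k) _ (List.nodup_finRange n) ∅ (by simp))
    (by rw [hvars]; exact hasSimpleSocle_span_range_X)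
    ⟨1, fun j hj p hp => by rw [hvars]; exact hp.mem_span_range_X hj⟩
  simp only [List.length_finRange, List.length_nil, add_zero, zero_add] at hlen hsoc
  have hGJ : Ideal.ofList G ≤ J := Ideal.span_le.2 fun g hg => (hG g hg).1
  by_cases hJG : J ≤ Ideal.ofList G
  · left
    obtain ⟨g, rfl⟩ : ∃ g : Fin n → MvPolynomial (Fin n) k, List.ofFn g = G :=
      ⟨fun i => G.get (i.cast hlen.symm), by
        rw [List.ofFn_congr hlen.symm]; exact List.ofFn_get G⟩
    refine ⟨g, fun i => (hG _ (List.mem_ofFn.2 ⟨i, rfl⟩)).2, ⟨hreg.isWeaklyRegular, ?_⟩, ?_⟩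
    · obtain ⟨w, -, hw, -⟩ := hsoc
      intro h
      rw [smul_eq_mul, Ideal.mul_top] at h
      exact hw (h ▸ Submodule.mem_top)
    · rw [le_antisymm hJG hGJ]
      simp [Ideal.ofList, Set.range]
  · right
    exact fun p hp => hsoc.mem_of_not_le
      (homogeneousComponent_mem_ofList fun g hg => ⟨d, (hG g hg).2⟩) hhigh hGJ hJG hp
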